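/- arXiv:1804.06122 — 4 statements merged into one kernel-verified Lean document; each statement's English description precedes it below -/
import Mathlib

section
/- Let U ⊆ ℝⁿ be an open set and let φ : ℝⁿ → ℝⁿ be of class C² on U. Let k ≥ 1 be an integer and let x be a point such that φ^j(x) ∈ U for all 0 ≤ j ≤ k−1 (so that the k-th iterate φ^k is defined and twice differentiable at x). Then for all vectors u, v ∈ ℝⁿ the second derivative of the k-th iterate satisfies D²(φ^k)(x)[u,v] = D²φ(φ^{k−1}(x))[Dφ^{k−1}(x)u, Dφ^{k−1}(x)v] + Σ_{j=1}^{k−1} Dφ^{k−j}(φ^{j}(x)) ( D²φ(φ^{j−1}(x))[Dφ^{j−1}(x)u, Dφ^{j−1}(x)v] ), where φ^m denotes the m-th iterate of φ (φ^0 = identity), Dφ^m(y) denotes the first (Fréchet) derivative of the m-th iterate at y, and D²ψ(y) denotes the second derivative of ψ at y viewed as a symmetric bilinear map ℝⁿ × ℝⁿ → ℝⁿ. -/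
open Function

section Helpers

variable {E : Type*} [NormedAddCommGroup E] [NormedSpace ℝ E]

lemma aux_contDiffAt_iterate (φ : E → E) (k : ℕ) :
    ∀ x : E, (∀ j, j < k → ContDiffAt ℝ 2 φ (φ^[j] x)) → ContDiffAt ℝ 2 (φ^[k]) x := by
  induction k with
  | zero => intro x _; exact contDiffAt_id
  | succ k ih =>
    intro x hx
    rw [Function.iterate_succ']
    exact (hx k (Nat.lt_succ_self k)).comp x (ih x fun j hj => hx j (by omega))

lemma aux_second_comp (f g : E → E) (x u v : E) (hf : ContDiffAt ℝ 2 f (g x))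
    (hg : ContDiffAt ℝ 2 g x) :
    fderiv ℝ (fderiv ℝ (f ∘ g)) x u v =
      fderiv ℝ (fderiv ℝ f) (g x) (fderiv ℝ g x u) (fderiv ℝ g x v) +
        fderiv ℝ f (g x) (fderiv ℝ (fderiv ℝ g) x u v) := by
  have hf1 : ∀ᶠ y in nhds (g x), ContDiffAt ℝ 2 f y := hf.eventually (by simp)
  have hg1 : ∀ᶠ y in nhds x, ContDiffAt ℝ 2 g y := hg.eventually (by simp)
  have heq : fderiv ℝ (f ∘ g) =ᶠ[nhds x]
      fun y => (fderiv ℝ f (g y)).comp (fderiv ℝ g y) := by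
    filter_upwards [hg.continuousAt.eventually hf1, hg1] with y h1 h2
    exact fderiv_comp y (h1.differentiableAt (by norm_num)) (h2.differentiableAt (by norm_num))
  have hdf : DifferentiableAt ℝ (fderiv ℝ f) (g x) :=
    (hf.fderiv_right (m := 1) (by norm_num)).differentiableAt (by norm_num)
  have hdg : DifferentiableAt ℝ (fderiv ℝ g) x :=
    (hg.fderiv_right (m := 1) (by norm_num)).differentiableAt (by norm_num)
  have h0 : HasFDerivAt g (fderiv ℝ g x) x :=
    (hg.differentiableAt (by norm_num)).hasFDerivAt
  have h1 : HasFDerivAt (fun y => fderiv ℝ f (g y)) _ x := hdf.hasFDerivAt.comp x h0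
  rw [heq.fderiv_eq, (h1.clm_comp hdg.hasFDerivAt).fderiv]
  simp [add_comm]

lemma aux_second_iterate (φ : E → E) (x u v : E) (k : ℕ)
    (hx : ∀ j, j < k → ContDiffAt ℝ 2 φ (φ^[j] x)) :
    fderiv ℝ (fderiv ℝ (φ^[k])) x u v =
      ∑ j ∈ Finset.range k, fderiv ℝ (φ^[k - 1 - j]) (φ^[j + 1] x)
        (fderiv ℝ (fderiv ℝ φ) (φ^[j] x) (fderiv ℝ (φ^[j]) x u) (fderiv ℝ (φ^[j]) x v)) := by
  induction k with
  | zero =>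
    have : fderiv ℝ (id : E → E) = fun _ => ContinuousLinearMap.id ℝ E := by
      ext1 y; exact fderiv_id
    simp [this]
  | succ k ih =>
    have hk := aux_contDiffAt_iterate φ k x fun j hj => hx j (by omega)
    rw [Function.iterate_succ', aux_second_comp φ _ x u v (hx k (by omega)) hk,
      ih fun j hj => hx j (by omega), Finset.sum_range_succ, map_sum, add_comm]
    congr 1
    · refine Finset.sum_congr rfl fun j hj => ?_
      have hj : j < k := Finset.mem_range.mp hj
      have e : k + 1 - 1 - j = (k - 1 - j) + 1 := by omega
      have e2 : φ^[k - 1 - j] (φ^[j + 1] x) = φ^[k] x := by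
        rw [← Function.iterate_add_apply]; congr 2; omega
      have h1 : DifferentiableAt ℝ (φ^[k - 1 - j]) (φ^[j + 1] x) := by
        refine (aux_contDiffAt_iterate φ _ _ fun i hi => ?_).differentiableAt (by norm_num)
        rw [← Function.iterate_add_apply]
        exact hx _ (by omega)
      have h2 : DifferentiableAt ℝ φ (φ^[k - 1 - j] (φ^[j + 1] x)) := by
        rw [e2]; exact (hx k (by omega)).differentiableAt (by norm_num)
      rw [e, Function.iterate_succ' φ (k - 1 - j), fderiv_comp _ h2 h1, e2]
      rfl
    · simp

end Helpers

/-- Chain rule for the second derivative of the `k`-th iterate of a `C²` map on ℝⁿ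
(Lemma 3.4 of the paper). -/
theorem second_derivative_chain_rule_iterate
    (n : ℕ) (U : Set (EuclideanSpace ℝ (Fin n)))
    (φ : EuclideanSpace ℝ (Fin n) → EuclideanSpace ℝ (Fin n))
    (hU : IsOpen U) (hφ : ContDiffOn ℝ 2 φ U)
    (k : ℕ) (hk : 1 ≤ k)
    (x : EuclideanSpace ℝ (Fin n)) (hx : ∀ j, j < k → φ^[j] x ∈ U)
    (u v : EuclideanSpace ℝ (Fin n)) :
    fderiv ℝ (fderiv ℝ (φ^[k])) x u v =
      fderiv ℝ (fderiv ℝ φ) (φ^[k - 1] x)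
        (fderiv ℝ (φ^[k - 1]) x u) (fderiv ℝ (φ^[k - 1]) x v) +
      ∑ j ∈ Finset.Ico 1 k,
        fderiv ℝ (φ^[k - j]) (φ^[j] x)
          (fderiv ℝ (fderiv ℝ φ) (φ^[j - 1] x)
            (fderiv ℝ (φ^[j - 1]) x u) (fderiv ℝ (φ^[j - 1]) x v)) := by
  have hx' : ∀ j, j < k → ContDiffAt ℝ 2 φ (φ^[j] x) := fun j hj =>
    hφ.contDiffAt (hU.mem_nhds (hx j hj))
  rw [aux_second_iterate φ x u v k hx']
  obtain ⟨m, rfl⟩ : ∃ m, k = m + 1 := ⟨k - 1, by omega⟩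
  rw [Finset.sum_range_succ, add_comm, Finset.sum_Ico_eq_sum_range]
  congr 1
  · simp
  · refine Finset.sum_congr rfl fun j _ => ?_
    have e1 : m + 1 - 1 - j = m + 1 - (1 + j) := by omega
    have e2 : 1 + j - 1 = j := by omega
    rw [e1, e2, add_comm j 1]
end

section
/- For every real number s with s > (1/2)·log 2, one has sinh(s) · log((1 + e^{−s})/(1 − e^{−s})) < 1 − (1/3)·e^{−2s}. -/
/-- Estimate (4.6) of the paper: for `s > (1/2)·log 2`, McMullen's universal function
`Φ(s) = sinh(s)·log((1+e^{−s})/(1−e^{−s}))` satisfies `Φ(s) < 1 − (1/3)·e^{−2s}`. -/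
theorem mcmullen_function_estimate (s : ℝ) (hs : (1 / 2) * Real.log 2 < s) :
    Real.sinh s * Real.log ((1 + Real.exp (-s)) / (1 - Real.exp (-s))) <
      1 - (1 / 3) * Real.exp (-2 * s) := by
  have hs0 : 0 < s := lt_trans (by have := Real.log_pos (one_lt_two : (1 : ℝ) < 2); linarith) hs
  have h2 : Real.exp (-2 * s) = Real.exp (-s) ^ 2 := by
    rw [← Real.exp_nat_mul]; congr 1; push_cast; ring
  have h3 : Real.sinh s = ((Real.exp (-s))⁻¹ - Real.exp (-s)) / 2 := by
    rw [Real.sinh_eq, Real.exp_neg, inv_inv]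
  have hx1 : Real.exp (-s) < 1 := by rw [Real.exp_lt_one_iff]; linarith
  have hx0 := Real.exp_pos (-s)
  rw [h2, h3]
  generalize Real.exp (-s) = x at *
  have h1x : 0 < 1 - x := by linarith
  have ht : 1 < (1 + x) / (1 - x) := by rw [lt_div_iff₀ h1x]; linarith
  obtain ⟨u, hu⟩ : ∃ u, u = Real.log ((1 + x) / (1 - x)) / 2 := ⟨_, rfl⟩
  have hL : Real.log ((1 + x) / (1 - x)) = 2 * u := by linarith
  have hu0 : 0 < u := by have := Real.log_pos ht; linarith
  have hsh := Real.self_lt_sinh_iff.2 hu0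
  have ha : Real.exp u ^ 2 = (1 + x) / (1 - x) := by
    rw [← Real.exp_nat_mul]; push_cast; rw [← hL, Real.exp_log (by linarith)]
  rw [Real.sinh_eq, Real.exp_neg] at hsh
  have ha0 := Real.exp_pos u
  rw [hL]
  generalize Real.exp u = a at *
  have ha2 : a ^ 2 * (1 - x) = 1 + x := by rw [ha]; field_simp
  have hb : (1 - x) * a ≤ 1 - x ^ 2 / 2 := by
    refine (sq_le_sq₀ (by positivity) (by nlinarith)).1 ?_
    have : ((1 - x) * a) ^ 2 = 1 - x ^ 2 := by linear_combination (1 - x) * ha2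
    nlinarith [sq_nonneg (x ^ 2)]
  have hp : 0 < (x⁻¹ - x) / 2 := by
    have := (one_lt_inv₀ hx0).2 hx1
    linarith
  have key : (x⁻¹ - x) / 2 * (a - a⁻¹) = (1 - x) * a := by
    field_simp
    linear_combination (1 + x - 2 * x) * ha2
  nlinarith [mul_lt_mul_of_pos_left hsh hp, sq_pos_of_pos hx0]
end

section
/- Let 0 ≤ x < 1 and 0 < r < 1 − x, and define the Möbius transformation φ(ζ) = (ζ − x)/(1 − xζ). Then φ maps the open unit disk 𝔻 bijectively onto itself, φ(x) = 0, and the image φ(D(x,r)) of the open Euclidean disk D(x,r) of center x and radius r contains the open disk D(0, r/(1 − x² + rx)) centered at the origin. -/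
open Metric

lemma moeb_ne (x : ℝ) (hx : |x| < 1) (z : ℂ) (hz : ‖z‖ < 1) : 1 - (x : ℂ) * z ≠ 0 := by
  intro h
  have h1 : (x : ℂ) * z = 1 := by linear_combination -h
  have h2 : |x| * ‖z‖ = 1 := by
    have := congrArg norm h1
    simpa using this
  nlinarith [abs_nonneg x, norm_nonneg z]

lemma moeb_lt (x : ℝ) (hx : |x| < 1) (z : ℂ) (hz : ‖z‖ < 1) :
    ‖(z - (x : ℂ)) / (1 - (x : ℂ) * z)‖ < 1 := by
  have hne := moeb_ne x hx z hz
  rw [norm_div, div_lt_one (norm_pos_iff.mpr hne)]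
  have hx2 : x ^ 2 < 1 := by rw [sq_lt_one_iff_abs_lt_one]; exact hx
  have hz2 : ‖z‖ ^ 2 < 1 := by nlinarith [norm_nonneg z]
  apply lt_of_pow_lt_pow_left₀ 2 (norm_nonneg _)
  rw [Complex.sq_norm, Complex.normSq_apply] at hz2 ⊢
  rw [Complex.sq_norm, Complex.normSq_apply]
  simp only [Complex.sub_re, Complex.sub_im, Complex.mul_re, Complex.mul_im, Complex.one_re,
    Complex.one_im, Complex.ofReal_re, Complex.ofReal_im]
  nlinarith [mul_pos (sub_pos.mpr hx2) (sub_pos.mpr hz2)]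

lemma moeb_inv (x : ℝ) (hx : |x| < 1) (z : ℂ) (hz : ‖z‖ < 1) :
    ((z - (x : ℂ)) / (1 - (x : ℂ) * z) + x) / (1 + x * ((z - (x : ℂ)) / (1 - (x : ℂ) * z))) = z := by
  have hne := moeb_ne x hx z hz
  have h2 : (1 : ℂ) - (x : ℂ) * x ≠ 0 := moeb_ne x hx x (by simpa using hx)
  have e1 : (z - (x : ℂ)) / (1 - (x : ℂ) * z) + x = z * (1 - x * x) / (1 - (x : ℂ) * z) := by
    rw [div_add' _ _ _ hne]; congr 1; ring
  have e2 : 1 + x * ((z - (x : ℂ)) / (1 - (x : ℂ) * z)) = (1 - x * x) / (1 - (x : ℂ) * z) := by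
    rw [mul_div_assoc', add_div' _ _ _ hne]; congr 1; ring
  rw [e1, e2, div_div_div_cancel_right₀ hne, mul_div_assoc, div_self h2, mul_one]

/-- Geometric content of Lemma 4.5 of the paper: the Möbius transformation
`φ(ζ) = (ζ − x)/(1 − xζ)` is an automorphism of the unit disk sending `x` to `0`, and the
image of `D(x,r)` contains the round disk `D(0, r/(1 − x² + rx))`. -/
theorem moebius_disk_image (x r : ℝ) (hx₀ : 0 ≤ x) (hx₁ : x < 1) (hr₀ : 0 < r)
    (hr₁ : r < 1 - x) :
    Set.BijOn (fun ζ : ℂ => (ζ - (x : ℂ)) / (1 - (x : ℂ) * ζ))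
        (Metric.ball (0 : ℂ) 1) (Metric.ball (0 : ℂ) 1) ∧
    ((x : ℂ) - (x : ℂ)) / (1 - (x : ℂ) * (x : ℂ)) = 0 ∧
    Metric.ball (0 : ℂ) (r / (1 - x ^ 2 + r * x)) ⊆
      (fun ζ : ℂ => (ζ - (x : ℂ)) / (1 - (x : ℂ) * ζ)) '' Metric.ball (x : ℂ) r := by
  have hx : |x| < 1 := by rw [abs_of_nonneg hx₀]; exact hx₁
  have hx' : |-x| < 1 := by rwa [abs_neg]
  have hsurj : ∀ w : ℂ, ‖w‖ < 1 → ‖(w + x) / (1 + x * w)‖ < 1 ∧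
      ((w + x) / (1 + x * w) - (x : ℂ)) / (1 - (x : ℂ) * ((w + x) / (1 + x * w))) = w := by
    intro w hw
    have h1 := moeb_lt (-x) hx' w hw
    have h2 := moeb_inv (-x) hx' w hw
    simp only [Complex.ofReal_neg, sub_neg_eq_add, neg_mul, ← sub_eq_add_neg] at h1 h2
    exact ⟨h1, h2⟩
  refine ⟨⟨?_, ?_, ?_⟩, by simp, ?_⟩
  · intro z hz
    rw [mem_ball_zero_iff] at hz ⊢
    exact moeb_lt x hx z hz
  · intro a ha b hb hab
    rw [mem_ball_zero_iff] at ha hb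
    simp only at hab
    rw [← moeb_inv x hx a ha, hab, moeb_inv x hx b hb]
  · intro w hw
    rw [mem_ball_zero_iff] at hw
    exact ⟨_, mem_ball_zero_iff.mpr (hsurj w hw).1, (hsurj w hw).2⟩
  · intro w hw
    rw [mem_ball_zero_iff] at hw
    have hd : 0 < 1 - x ^ 2 + r * x := by nlinarith [mul_nonneg hr₀.le hx₀]
    rw [lt_div_iff₀ hd] at hw
    have hw0 := norm_nonneg w
    have hw1 : ‖w‖ < 1 := by
      by_contra h
      push Not at h
      nlinarith
    refine ⟨(w + x) / (1 + x * w), ?_, (hsurj w hw1).2⟩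
    have hne : 1 + (x : ℂ) * w ≠ 0 := by
      have := moeb_ne (-x) hx' w hw1
      simpa using this
    have e : (w + x) / (1 + x * w) - (x : ℂ) = w * ((1 - x ^ 2 : ℝ) : ℂ) / (1 + x * w) := by
      rw [div_sub' hne]; congr 1; push_cast; ring
    have hp : 0 < 1 - x ^ 2 := by nlinarith
    rw [mem_ball_iff_norm, e, norm_div, norm_mul, Complex.norm_real, Real.norm_of_nonneg hp.le,
      div_lt_iff₀ (norm_pos_iff.mpr hne)]
    have hl : 1 - x * ‖w‖ ≤ ‖1 + (x : ℂ) * w‖ := by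
      have := norm_sub_le (1 + (x : ℂ) * w) ((x : ℂ) * w)
      rw [add_sub_cancel_right, norm_mul, Complex.norm_real, Real.norm_of_nonneg hx₀, norm_one] at this
      linarith
    nlinarith [mul_le_mul_of_nonneg_left hl hr₀.le]
end

section
/- Let M > 1 and set λ = 1/M. Let α > 1, 0 < θ < 1, let n₀ ≥ 2 be an integer, let r be a real number with r > 1 + 4n₀α/((n₀−1)(1−θ)(2α−1)), and let K₁ > 0, K₂ > 0 be arbitrary constants. For each integer n define ξ_n = (1 + K₁·λ^{2n·(1 − 1/(2α))^{−1}})·(1 − K₂·λ^{(n−1)(r−1)(1−θ)}). Then there exists an integer N ≥ n₀ such that for all n ≥ N one has 1 + M·(λ^{n−1}/(αM))^{r−1} ≤ ξ_n. -/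
/-- Lemma 7.1 of the paper: the purely numerical inequality comparing the local
quasiconformal distortion `1 + M·(λ^{n−1}/(αM))^{r−1}` with the expansion factor
`ξ_n = (1 + K₁·λ^{2n(1−1/(2α))^{−1}})·(1 − K₂·λ^{(n−1)(r−1)(1−θ)})`, where `λ = 1/M`,
valid for all sufficiently large `n` under the smoothness condition on `r`. -/
theorem dilatation_vs_expansion
    (M α θ r K₁ K₂ : ℝ) (n₀ : ℕ)
    (hM : 1 < M) (hα : 1 < α) (hθ₀ : 0 < θ) (hθ₁ : θ < 1) (hn₀ : 2 ≤ n₀)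
    (hr : 1 + 4 * (n₀ : ℝ) * α / (((n₀ : ℝ) - 1) * (1 - θ) * (2 * α - 1)) < r)
    (hK₁ : 0 < K₁) (hK₂ : 0 < K₂) :
    ∃ N : ℕ, n₀ ≤ N ∧ ∀ n : ℕ, N ≤ n →
      1 + M * ((1 / M) ^ ((n : ℝ) - 1) / (α * M)) ^ (r - 1) ≤
        (1 + K₁ * (1 / M) ^ (2 * (n : ℝ) * (1 - 1 / (2 * α))⁻¹)) *
          (1 - K₂ * (1 / M) ^ (((n : ℝ) - 1) * (r - 1) * (1 - θ))) := by
  have hn : (2 : ℝ) ≤ n₀ := by exact_mod_cast hn₀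
  have h1 : 0 < (n₀ : ℝ) - 1 := by linarith
  have h2 : 0 < 1 - θ := by linarith
  have h3 : 0 < 2 * α - 1 := by linarith
  have hM0 : 0 < M := by linarith
  obtain ⟨c, hc⟩ : ∃ c, c = 4 * α / (2 * α - 1) := ⟨_, rfl⟩
  have hc0 : 0 < c := by rw [hc]; positivity
  have hce : ∀ n : ℝ, 2 * n * (1 - 1 / (2 * α))⁻¹ = c * n := by
    intro n
    have : 1 - 1 / (2 * α) = (2 * α - 1) / (2 * α) := by field_simp
    rw [this, hc, inv_div]
    ring
  have hs0 : 0 < r - 1 := by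
    have : 0 < 4 * (n₀ : ℝ) * α / (((n₀ : ℝ) - 1) * (1 - θ) * (2 * α - 1)) := by positivity
    linarith
  have hcd : c < (r - 1) * (1 - θ) := by
    have hr' : 4 * (n₀ : ℝ) * α / (((n₀ : ℝ) - 1) * (1 - θ) * (2 * α - 1)) < r - 1 := by linarith
    have e : 4 * (n₀ : ℝ) * α / (((n₀ : ℝ) - 1) * (1 - θ) * (2 * α - 1))
        = c * (n₀ / (n₀ - 1)) / (1 - θ) := by
      rw [hc]; field_simp
    rw [e, div_lt_iff₀ h2] at hr'
    have : 1 ≤ (n₀ : ℝ) / (n₀ - 1) := by rw [le_div_iff₀ h1]; linarith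
    nlinarith
  obtain ⟨d, hd⟩ : ∃ d, d = (r - 1) * (1 - θ) := ⟨_, rfl⟩
  rw [← hd] at hcd
  obtain ⟨l, hl⟩ : ∃ l, l = 1 / M := ⟨_, rfl⟩
  have hl0 : 0 < l := by rw [hl]; positivity
  have hl1 : l < 1 := by rw [hl, div_lt_one hM0]; exact hM
  rw [← hl]
  have hq0 : 0 < l ^ (d - c) := Real.rpow_pos_of_pos hl0 _
  have hq1 : l ^ (d - c) < 1 := Real.rpow_lt_one hl0.le hl1 (by linarith)
  have ht := (tendsto_pow_atTop_nhds_zero_of_lt_one hq0.le hq1).const_mul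
    ((M + K₂ + K₁ * K₂) * l ^ (-d))
  rw [mul_zero] at ht
  obtain ⟨N, hN⟩ := Filter.eventually_atTop.1 (ht.eventually (gt_mem_nhds hK₁))
  refine ⟨max n₀ N, le_max_left _ _, fun n hnn => ?_⟩
  have hNn := hN n (le_trans (le_max_right _ _) hnn)
  have hn2 : (2 : ℝ) ≤ n := by exact_mod_cast hn₀.trans ((le_max_left _ _).trans hnn)
  rw [hce, mul_assoc ((n : ℝ) - 1), ← hd]
  have hA0 : 0 < l ^ (c * n) := Real.rpow_pos_of_pos hl0 _
  have hA1 : l ^ (c * n) ≤ 1 := Real.rpow_le_one hl0.le hl1.le (by positivity)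
  have hB0 : 0 < l ^ (((n : ℝ) - 1) * d) := Real.rpow_pos_of_pos hl0 _
  have hBA : l ^ (((n : ℝ) - 1) * d) = l ^ (c * n) * (l ^ (-d) * (l ^ (d - c)) ^ n) := by
    rw [← Real.rpow_natCast, ← Real.rpow_mul hl0.le, ← Real.rpow_add hl0, ← Real.rpow_add hl0]
    congr 1; ring
  have hD : (l ^ ((n : ℝ) - 1) / (α * M)) ^ (r - 1) ≤ l ^ (((n : ℝ) - 1) * d) := by
    have hp : 0 < l ^ ((n : ℝ) - 1) := Real.rpow_pos_of_pos hl0 _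
    calc (l ^ ((n : ℝ) - 1) / (α * M)) ^ (r - 1) ≤ (l ^ ((n : ℝ) - 1)) ^ (r - 1) := by
          apply Real.rpow_le_rpow (by positivity) _ hs0.le
          exact div_le_self hp.le (by nlinarith)
      _ = l ^ (((n : ℝ) - 1) * (r - 1)) := by rw [← Real.rpow_mul hl0.le]
      _ ≤ _ := by
          apply Real.rpow_le_rpow_of_exponent_ge hl0 hl1.le
          apply mul_le_mul_of_nonneg_left _ (by linarith)
          rw [hd]; nlinarith
  have hkey : (M + K₂ + K₁ * K₂) * l ^ (((n : ℝ) - 1) * d) ≤ K₁ * l ^ (c * n) := by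
    rw [hBA]
    nlinarith [mul_le_mul_of_nonneg_left hNn.le hA0.le]
  have hMD := mul_le_mul_of_nonneg_left hD hM0.le
  have hAB := mul_le_mul_of_nonneg_left hA1 (mul_pos (mul_pos hK₁ hK₂) hB0).le
  nlinarith
end
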